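/- For every real κ ≥ 1 and every integer k ≥ 3√κ, (1 + k/(√κ + 1)) (1 − 1/√κ)^k ≤ (1 − 1/(2√κ))^k. Consequently, k*(κ) ≤ ⌈3√κ⌉; in particular there is an absolute constant C ≥ 1 with k*(κ) ≤ C√κ for all κ ≥ 1. -/

import Mathlib

/-- `k*(κ)`: the smallest positive integer `m` such that
`(1 + k/(√κ + 1))(1 − 1/√κ)^k ≤ (1 − 1/(2√κ))^k` for every integer `k ≥ m`. -/
noncomputable def kstar (κ : ℝ) : ℕ :=
  sInf {m : ℕ | 0 < m ∧ ∀ k : ℕ, m ≤ k →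
    (1 + (k : ℝ) / (Real.sqrt κ + 1)) * (1 - 1 / Real.sqrt κ) ^ k
      ≤ (1 - 1 / (2 * Real.sqrt κ)) ^ k}

/-- `1 + x ≤ exp (x / 2)` as soon as `3 ≤ x`. -/
theorem one_add_le_exp_half {x : ℝ} (hx : 3 ≤ x) : 1 + x ≤ Real.exp (x / 2) := by
  have h4 : (4 : ℝ) ≤ Real.exp (3 / 2) := by
    have hsq : Real.exp (3 / 2) ^ 2 = Real.exp 1 ^ 3 := by
      rw [← Real.exp_nat_mul, ← Real.exp_nat_mul]
      norm_num
    have hcube : (2.7 : ℝ) ^ 3 ≤ Real.exp 1 ^ 3 :=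
      pow_le_pow_left₀ (by norm_num) (by linarith [Real.exp_one_gt_d9]) 3
    exact le_of_sq_le_sq (by rw [hsq]; norm_num at hcube ⊢; linarith) (Real.exp_pos _).le
  have hlin : (x - 3) / 2 + 1 ≤ Real.exp ((x - 3) / 2) := Real.add_one_le_exp _
  calc 1 + x ≤ 4 * ((x - 3) / 2 + 1) := by linarith
    _ ≤ Real.exp (3 / 2) * Real.exp ((x - 3) / 2) :=
      mul_le_mul h4 hlin (by linarith) (Real.exp_pos _).le
    _ = Real.exp (x / 2) := by
      rw [← Real.exp_add]
      ring_nf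

theorem one_add_div_mul_pow_le {s : ℝ} (hs : 1 ≤ s) {k : ℕ} (hk : 3 * s ≤ k) :
    (1 + (k : ℝ) / (s + 1)) * (1 - 1 / s) ^ k ≤ (1 - 1 / (2 * s)) ^ k := by
  have hs0 : 0 < s := by linarith
  have hinv : 1 / s ≤ 1 := (div_le_one hs0).2 hs
  have hhalf : 1 / (2 * s) = 1 / s / 2 := by
    field_simp
  have hu : 0 ≤ 1 - 1 / (2 * s) := by
    rw [hhalf]
    linarith
  have hbase : 1 - 1 / s ≤ (1 - 1 / (2 * s)) * Real.exp (-(1 / (2 * s))) := by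
    have hexp := mul_le_mul_of_nonneg_left (Real.one_sub_le_exp_neg (1 / (2 * s))) hu
    refine le_trans ?_ hexp
    rw [hhalf]
    nlinarith [sq_nonneg (1 / s)]
  have hpow : (1 - 1 / s) ^ k ≤ (1 - 1 / (2 * s)) ^ k * Real.exp (-((k : ℝ) / s / 2)) := by
    refine (pow_le_pow_left₀ (by linarith) hbase k).trans_eq ?_
    rw [mul_pow, ← Real.exp_nat_mul]
    congr 2
    field_simp
  have hfactor : 1 + (k : ℝ) / (s + 1) ≤ Real.exp ((k : ℝ) / s / 2) := by
    refine le_trans ?_ (one_add_le_exp_half ((le_div_iff₀ hs0).2 hk))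
    gcongr
    linarith
  calc (1 + (k : ℝ) / (s + 1)) * (1 - 1 / s) ^ k
      ≤ Real.exp ((k : ℝ) / s / 2) *
          ((1 - 1 / (2 * s)) ^ k * Real.exp (-((k : ℝ) / s / 2))) :=
        mul_le_mul hfactor hpow (pow_nonneg (by linarith) k) (Real.exp_pos _).le
    _ = (1 - 1 / (2 * s)) ^ k := by
        rw [mul_left_comm, ← Real.exp_add, add_neg_cancel, Real.exp_zero, mul_one]

theorem kstar_le_ceil {κ : ℝ} (hκ : 1 ≤ κ) : kstar κ ≤ ⌈3 * Real.sqrt κ⌉₊ := by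
  have hs : 1 ≤ Real.sqrt κ := Real.one_le_sqrt.2 hκ
  exact Nat.sInf_le ⟨Nat.ceil_pos.2 (by linarith),
    fun k hk => one_add_div_mul_pow_le hs (Nat.ceil_le.1 hk)⟩

/-- For every real `κ ≥ 1` and every integer `k ≥ 3√κ`,
`(1 + k/(√κ + 1)) (1 − 1/√κ)^k ≤ (1 − 1/(2√κ))^k`. Consequently `k*(κ) ≤ ⌈3√κ⌉`, and in
particular there is an absolute constant `C ≥ 1` with `k*(κ) ≤ C√κ` for all `κ ≥ 1`. -/
theorem kstar_le_sqrt_kappa :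
    (∀ κ : ℝ, 1 ≤ κ → ∀ k : ℕ, 3 * Real.sqrt κ ≤ (k : ℝ) →
      (1 + (k : ℝ) / (Real.sqrt κ + 1)) * (1 - 1 / Real.sqrt κ) ^ k
        ≤ (1 - 1 / (2 * Real.sqrt κ)) ^ k) ∧
    (∀ κ : ℝ, 1 ≤ κ → kstar κ ≤ ⌈3 * Real.sqrt κ⌉₊) ∧
    ∃ C : ℝ, 1 ≤ C ∧ ∀ κ : ℝ, 1 ≤ κ → (kstar κ : ℝ) ≤ C * Real.sqrt κ := by
  refine ⟨fun κ hκ k hk => one_add_div_mul_pow_le (Real.one_le_sqrt.2 hκ) hk,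
    fun κ hκ => kstar_le_ceil hκ, 4, by norm_num, fun κ hκ => ?_⟩
  have hs : 1 ≤ Real.sqrt κ := Real.one_le_sqrt.2 hκ
  have hceil : (kstar κ : ℝ) ≤ (⌈3 * Real.sqrt κ⌉₊ : ℝ) := by
    exact_mod_cast kstar_le_ceil hκ
  have hlt := Nat.ceil_lt_add_one (show 0 ≤ 3 * Real.sqrt κ by linarith)
  linarith
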